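/- arXiv:1907.11742 — 6 statements merged into one kernel-verified Lean document; each statement's English description precedes it below -/
import Mathlib

section
/- Let f : ℝⁿ → ℝ be convex, let S ⊂ ℝⁿ be a finite nonempty set of points at which f is differentiable, and let L ≥ 0 satisfy |∇f(s)| ≤ L for all s ∈ S. Let λ ∈ Δ_S, set s̄ = Σ_{s∈S} λ_s s and δ = |Σ_{s∈S} λ_s ∇f(s)|. Then for every x ∈ ℝⁿ one has f(s̄) ≤ f(x) + δ|x − s̄| + L·diam(S), where diam(S) = max{|s − s'| : s, s' ∈ S}. In particular inf f ≤ f(s̄) ≤ inf_x { f(x) + δ|x − s̄| } + L·diam(S). -/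
open scoped RealInnerProductSpace

/-- First-order characterization of convexity: a convex function lies above its tangent
hyperplanes. -/
theorem ConvexOn.add_inner_gradient_le {E : Type*} [NormedAddCommGroup E]
    [InnerProductSpace ℝ E] [CompleteSpace E] {f : E → ℝ} (hf : ConvexOn ℝ Set.univ f)
    {s : E} (hs : DifferentiableAt ℝ f s) (x : E) :
    f s + ⟪gradient f s, x - s⟫ ≤ f x := by
  have hd : HasDerivAt (f ∘ AffineMap.lineMap s x) ⟪gradient f s, x - s⟫ (0 : ℝ) := by
    have hfd : HasFDerivAt f (InnerProductSpace.toDual ℝ E (gradient f s))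
        (AffineMap.lineMap s x (0 : ℝ)) := by
      simpa using hs.hasGradientAt.hasFDerivAt
    simpa using hfd.comp_hasDerivAt (0 : ℝ) AffineMap.hasDerivAt_lineMap
  have hc : ConvexOn ℝ Set.univ (f ∘ AffineMap.lineMap (k := ℝ) s x) := by
    simpa using hf.comp_affineMap (AffineMap.lineMap (k := ℝ) s x)
  have h := hc.le_slope_of_hasDerivAt (Set.mem_univ 0) (Set.mem_univ 1) one_pos hd
  simp only [slope_def_field, Function.comp_apply, AffineMap.lineMap_apply_one,
    AffineMap.lineMap_apply_zero, sub_zero, div_one] at h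
  linarith

/-- A convex combination of points of a finite set is within the diameter of each of its points. -/
theorem Finset.norm_sum_smul_sub_le_diam {E : Type*} [NormedAddCommGroup E] [NormedSpace ℝ E]
    {S : Finset E} {w : E → ℝ} (hw₀ : ∀ s ∈ S, 0 ≤ w s) (hw₁ : ∑ s ∈ S, w s = 1)
    {t : E} (ht : t ∈ S) : ‖∑ s ∈ S, w s • s - t‖ ≤ Metric.diam (S : Set E) := by
  rw [← mem_closedBall_iff_norm]
  refine (convex_closedBall t _).sum_mem hw₀ hw₁ fun s hs => ?_
  exact Metric.dist_le_diam_of_mem S.finite_toSet.isBounded hs ht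

/-- approximate optimality certificate from a bundle. -/
theorem stmt0 {n : ℕ} (f : EuclideanSpace ℝ (Fin n) → ℝ)
    (hconv : ConvexOn ℝ Set.univ f)
    (S : Finset (EuclideanSpace ℝ (Fin n))) (hS : S.Nonempty)
    (hdiff : ∀ s ∈ S, DifferentiableAt ℝ f s)
    (L : ℝ) (hL : 0 ≤ L) (hgrad : ∀ s ∈ S, ‖gradient f s‖ ≤ L)
    (lam : EuclideanSpace ℝ (Fin n) → ℝ)
    (hlam0 : ∀ s ∈ S, 0 ≤ lam s) (hlam1 : ∑ s ∈ S, lam s = 1)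
    (sbar : EuclideanSpace ℝ (Fin n)) (hsbar : sbar = ∑ s ∈ S, lam s • s)
    (δ : ℝ) (hδ : δ = ‖∑ s ∈ S, lam s • gradient f s‖) :
    ∀ x : EuclideanSpace ℝ (Fin n),
      f sbar ≤ f x + δ * ‖x - sbar‖ + L * Metric.diam (S : Set (EuclideanSpace ℝ (Fin n))) := by
  intro x
  subst hsbar hδ
  set c := ∑ s ∈ S, lam s • s
  set D := Metric.diam (S : Set (EuclideanSpace ℝ (Fin n)))
  have jensen : f c ≤ ∑ s ∈ S, lam s * f s := by
    simpa using hconv.map_sum_le hlam0 hlam1 fun s _ => Set.mem_univ s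
  have tangent : ∀ s ∈ S, f s + ⟪gradient f s, x - c⟫ - L * D ≤ f x := by
    intro s hs
    have h₁ := hconv.add_inner_gradient_le (hdiff s hs) x
    have h₂ : -(L * D) ≤ ⟪gradient f s, c - s⟫ := by
      refine (neg_le_neg ?_).trans (neg_le_of_abs_le (abs_real_inner_le_norm _ _))
      exact mul_le_mul (hgrad s hs) (Finset.norm_sum_smul_sub_le_diam hlam0 hlam1 hs)
        (norm_nonneg _) hL
    rw [← sub_add_sub_cancel x c s, inner_add_right] at h₁
    linarith
  have avg : ∑ s ∈ S, lam s * (f s + ⟪gradient f s, x - c⟫ - L * D) ≤ f x := by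
    calc _ ≤ ∑ s ∈ S, lam s * f x :=
          Finset.sum_le_sum fun s hs => mul_le_mul_of_nonneg_left (tangent s hs) (hlam0 s hs)
      _ = f x := by rw [← Finset.sum_mul, hlam1, one_mul]
  have expand : ∑ s ∈ S, lam s * (f s + ⟪gradient f s, x - c⟫ - L * D)
      = ∑ s ∈ S, lam s * f s + ⟪∑ s ∈ S, lam s • gradient f s, x - c⟫ - L * D := by
    simp only [mul_sub, mul_add, Finset.sum_sub_distrib, Finset.sum_add_distrib, sum_inner,
      real_inner_smul_left, ← Finset.sum_mul, hlam1, one_mul]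
  have cauchy := neg_le_of_abs_le
    (abs_real_inner_le_norm (∑ s ∈ S, lam s • gradient f s) (x - c))
  linarith
end

section
/- Let f : ℝⁿ → ℝ be Lipschitz on a neighborhood of a point x̄ and differentiable at every point of a set D ⊆ ℝⁿ. Define the limiting gradient set Γ = { g ∈ ℝⁿ : there exist points x_r ∈ D with x_r → x̄ and ∇f(x_r) → g }. For a k-element set S ⊂ D let σ_S denote the smallest singular value of the (n+1)×k matrix whose columns are the vectors (∇f(s), 1) ∈ ℝ^{n+1} for s ∈ S; equivalently σ_S = min{ |Σ_{s∈S} v_s (∇f(s),1)| : v ∈ ℝ^S, |v| = 1 }. Suppose there exist σ > 0 and a sequence of k-element sets S_r ⊂ D with max_{s∈S_r}|s − x̄| → 0 and σ_{S_r} ≥ σ for all r. Then Γ contains vectors g₁, …, g_k such that (g₁,1), …, (g_k,1) ∈ ℝ^{n+1} are linearly independent, i.e. g₁, …, g_k are affinely independent. -/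
open scoped RealInnerProductSpace

open Filter Topology in
/-- The gradients of a function that is Lipschitz near `a` are bounded near `a`. -/
theorem LipschitzOnWith.eventually_norm_gradient_le {E : Type*} [NormedAddCommGroup E]
    [InnerProductSpace ℝ E] [CompleteSpace E] {f : E → ℝ} {K : NNReal} {U : Set E} {a : E}
    (hf : LipschitzOnWith K f U) (hU : U ∈ 𝓝 a) : ∀ᶠ x in 𝓝 a, ‖gradient f x‖ ≤ K := by
  filter_upwards [eventually_mem_nhds_iff.2 hU] with x hx
  rw [gradient, LinearIsometryEquiv.norm_map]
  exact norm_fderiv_le_of_lipschitzOn ℝ hx hf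

/-- If the smallest singular value of the matrix with columns `(g i, 1)` is positive, then these
columns are linearly independent. -/
theorem linearIndependent_prod_one_of_le_norm {E ι : Type*} [NormedAddCommGroup E]
    [InnerProductSpace ℝ E] [Fintype ι] {g : ι → E} {σ : ℝ} (hσ : 0 < σ)
    (h : ∀ v : EuclideanSpace ℝ ι, ‖v‖ = 1 →
      σ ≤ ‖WithLp.toLp 2 (∑ i, v i • g i, ∑ i, v i)‖) :
    LinearIndependent ℝ (fun i => ((g i, 1) : E × ℝ)) := by
  rw [Fintype.linearIndependent_iff]
  intro c hc
  have hc₁ : ∑ i, c i • g i = 0 := by simpa [Prod.fst_sum] using congrArg Prod.fst hc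
  have hc₂ : ∑ i, c i = 0 := by simpa [Prod.snd_sum] using congrArg Prod.snd hc
  suffices hw : WithLp.toLp 2 c = (0 : EuclideanSpace ℝ ι) from fun i => by
    simpa using congrArg (fun w : EuclideanSpace ℝ ι => w i) hw
  by_contra hw
  have := h (‖WithLp.toLp 2 c‖⁻¹ • WithLp.toLp 2 c) (norm_smul_inv_norm hw)
  simp only [PiLp.smul_apply, smul_eq_mul, mul_smul, ← Finset.smul_sum, ← Finset.mul_sum,
    hc₁, hc₂, smul_zero, mul_zero] at this
  have h0 : ‖WithLp.toLp 2 ((0 : E), (0 : ℝ))‖ = 0 := norm_zero (E := WithLp 2 (E × ℝ))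
  linarith

/-- uniformly affinely independent gradients along shrinking bundles
yield `k` affinely independent limiting gradients. -/
theorem stmt2 {n k : ℕ} (f : EuclideanSpace ℝ (Fin n) → ℝ)
    (xbar : EuclideanSpace ℝ (Fin n)) (D : Set (EuclideanSpace ℝ (Fin n)))
    (K : NNReal) (U : Set (EuclideanSpace ℝ (Fin n))) (hU : U ∈ nhds xbar)
    (hlip : LipschitzOnWith K f U)
    (hdiff : ∀ x ∈ D, DifferentiableAt ℝ f x)
    (S : ℕ → Fin k → EuclideanSpace ℝ (Fin n))
    (hSD : ∀ r i, S r i ∈ D)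
    (hSinj : ∀ r, Function.Injective (S r))
    (hshrink : ∀ ε > (0:ℝ), ∃ N, ∀ r ≥ N, ∀ i, ‖S r i - xbar‖ < ε)
    (σ : ℝ) (hσ : 0 < σ)
    (hsing : ∀ r, ∀ v : EuclideanSpace ℝ (Fin k), ‖v‖ = 1 →
      σ ≤ ‖(WithLp.equiv 2 (EuclideanSpace ℝ (Fin n) × ℝ)).symm
        (∑ i, v i • gradient f (S r i), ∑ i, v i)‖) :
    ∃ g : Fin k → EuclideanSpace ℝ (Fin n),
      (∀ i, g i ∈ {h | ∃ x : ℕ → EuclideanSpace ℝ (Fin n), (∀ r, x r ∈ D) ∧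
        Filter.Tendsto x Filter.atTop (nhds xbar) ∧
        Filter.Tendsto (fun r => gradient f (x r)) Filter.atTop (nhds h)}) ∧
      LinearIndependent ℝ (fun i => ((g i, 1) : EuclideanSpace ℝ (Fin n) × ℝ)) := by
  have hS : ∀ i, Filter.Tendsto (fun r => S r i) Filter.atTop (nhds xbar) := fun i =>
    Metric.tendsto_atTop.2 fun ε hε => by
      obtain ⟨N, hN⟩ := hshrink ε hε
      exact ⟨N, fun r hr => by simpa [dist_eq_norm] using hN r hr i⟩
  have hbd : ∀ᶠ r in Filter.atTop, (fun i => gradient f (S r i)) ∈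
      Metric.closedBall (0 : Fin k → EuclideanSpace ℝ (Fin n)) K := by
    filter_upwards [Filter.eventually_all.2 fun i =>
      (hS i).eventually (hlip.eventually_norm_gradient_le hU)] with r hr
    simpa [pi_norm_le_iff_of_nonneg] using hr
  obtain ⟨g, -, φ, hφ, hg⟩ :=
    (isCompact_closedBall (0 : Fin k → EuclideanSpace ℝ (Fin n)) K).tendsto_subseq'
      hbd.frequently
  refine ⟨g, fun i => ⟨fun r => S (φ r) i, fun r => hSD _ i, (hS i).comp hφ.tendsto_atTop,
    tendsto_pi_nhds.1 hg i⟩, linearIndependent_prod_one_of_le_norm hσ fun v hv => ?_⟩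
  have hcont : Continuous fun G : Fin k → EuclideanSpace ℝ (Fin n) =>
      ‖WithLp.toLp 2 (∑ i, v i • G i, ∑ i, v i)‖ := by fun_prop
  exact ge_of_tendsto' ((hcont.tendsto g).comp hg) fun r => hsing (φ r) v hv
end

section
/- Let h₁, …, h_k : ℝⁿ → ℝ be twice continuously differentiable on a neighborhood of ȳ ∈ ℝⁿ, and let λ̄ ∈ ℝᵏ be such that the matrix Σᵢ λ̄_i ∇²h_i(ȳ) is positive definite on the subspace {z ∈ ℝⁿ : ∇h_i(ȳ)ᵀz = 0 for all i}. Then there exists δ > 0 such that for all points y₁, …, y_k ∈ ℝⁿ with |y_i − ȳ| ≤ δ for each i and all λ ∈ ℝᵏ with |λ − λ̄| ≤ δ, the matrix Σᵢ λ_i ∇²h_i(y_i) is positive definite on the subspace {z ∈ ℝⁿ : ∇h_i(y_i)ᵀz = 0 for all i}. -/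
open scoped RealInnerProductSpace

open Filter Topology

/-- Positivity of a quadratic form on the orthogonal complement of a family of vectors is stable
under perturbation of both the form and the vectors. -/
theorem eventually_pos_of_orthogonal {X ι E : Type*} [TopologicalSpace X] [NormedAddCommGroup E]
    [InnerProductSpace ℝ E] [ProperSpace E] {G : ι → X → E} {A : X → E →L[ℝ] E} {x₀ : X}
    (hG : ∀ i, ContinuousAt (G i) x₀) (hA : ContinuousAt A x₀)
    (hpos : ∀ z : E, z ≠ 0 → (∀ i, ⟪G i x₀, z⟫ = 0) → 0 < ⟪z, A x₀ z⟫) :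
    ∀ᶠ x in 𝓝 x₀, ∀ z : E, z ≠ 0 → (∀ i, ⟪G i x, z⟫ = 0) → 0 < ⟪z, A x z⟫ := by
  have hsphere : ∀ᶠ x in 𝓝 x₀, ∀ z ∈ Metric.sphere (0 : E) 1,
      (∀ i, ⟪G i x, z⟫ = 0) → 0 < ⟪z, A x z⟫ := by
    refine (isCompact_sphere (0 : E) 1).eventually_forall_of_forall_eventually fun z hz => ?_
    have hsnd : ContinuousAt (Prod.snd : X × E → E) (x₀, z) := continuousAt_snd
    by_cases horth : ∀ i, ⟪G i x₀, z⟫ = 0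
    · have hcont : ContinuousAt (fun p : X × E => ⟪p.2, A p.1 p.2⟫) (x₀, z) :=
        hsnd.inner ((ContinuousAt.fst'' (f := A) hA).clm_apply hsnd)
      filter_upwards [hcont.eventually_const_lt
        (hpos z (ne_zero_of_mem_unit_sphere ⟨z, hz⟩) horth)] with p hp _ using hp
    · obtain ⟨i, hi⟩ := not_forall.mp horth
      have hcont : ContinuousAt (fun p : X × E => ⟪G i p.1, p.2⟫) (x₀, z) :=
        (ContinuousAt.fst'' (f := G i) (hG i)).inner hsnd
      filter_upwards [hcont.eventually_ne hi] with p hp hp' using absurd (hp' i) hp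
  filter_upwards [hsphere] with x hx z hz horth
  have hz' : 0 < ‖z‖ := norm_pos_iff.mpr hz
  have hunit := hx (‖z‖⁻¹ • z) (by simp [norm_smul, hz'.ne'])
    fun i => by rw [inner_smul_right, horth i, mul_zero]
  rw [map_smul, inner_smul_left, inner_smul_right] at hunit
  have hinv : 0 < ‖z‖⁻¹ := inv_pos.mpr hz'
  exact pos_of_mul_pos_right (pos_of_mul_pos_right hunit hinv.le) hinv.le

/-- The gradient of a `C²` function is `C¹`. -/
theorem ContDiffAt.gradient_of_two {E : Type*} [NormedAddCommGroup E] [InnerProductSpace ℝ E]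
    [CompleteSpace E] {f : E → ℝ} {x : E} (hf : ContDiffAt ℝ 2 f x) :
    ContDiffAt ℝ 1 (gradient f) x :=
  (InnerProductSpace.toDual ℝ E).symm.contDiff.contDiffAt.comp x
    (hf.fderiv_right (by norm_num))

/-- stability of positive definiteness of the Lagrangian Hessian on the
tangent subspace under perturbation of reference points and multipliers. -/
theorem stmt6 {n k : ℕ} (h : Fin k → EuclideanSpace ℝ (Fin n) → ℝ)
    (ybar : EuclideanSpace ℝ (Fin n))
    (U : Set (EuclideanSpace ℝ (Fin n))) (hU : U ∈ nhds ybar)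
    (hC2 : ∀ i, ContDiffOn ℝ 2 (h i) U)
    (lambar : EuclideanSpace ℝ (Fin k))
    (hpos : ∀ z : EuclideanSpace ℝ (Fin n), z ≠ 0 →
      (∀ i, ⟪gradient (h i) ybar, z⟫ = 0) →
      0 < ⟪z, (∑ i, lambar i • fderiv ℝ (gradient (h i)) ybar) z⟫) :
    ∃ δ > (0:ℝ), ∀ (y : Fin k → EuclideanSpace ℝ (Fin n)) (lam : EuclideanSpace ℝ (Fin k)),
      (∀ i, ‖y i - ybar‖ ≤ δ) → ‖lam - lambar‖ ≤ δ →
      ∀ z : EuclideanSpace ℝ (Fin n), z ≠ 0 →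
        (∀ i, ⟪gradient (h i) (y i), z⟫ = 0) →
        0 < ⟪z, (∑ i, lam i • fderiv ℝ (gradient (h i)) (y i)) z⟫ := by
  have hgrad i : ContDiffAt ℝ 1 (gradient (h i)) ybar :=
    ((hC2 i).contDiffAt hU).gradient_of_two
  let x₀ : (Fin k → EuclideanSpace ℝ (Fin n)) × EuclideanSpace ℝ (Fin k) :=
    (fun _ => ybar, lambar)
  have hy i : ContinuousAt
      (fun x : (Fin k → EuclideanSpace ℝ (Fin n)) × EuclideanSpace ℝ (Fin k) =>
        x.1 i) x₀ := by fun_prop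
  have hG i : ContinuousAt
      (fun x : (Fin k → EuclideanSpace ℝ (Fin n)) × EuclideanSpace ℝ (Fin k) =>
        gradient (h i) (x.1 i)) x₀ :=
    ContinuousAt.comp' (hgrad i).continuousAt (hy i)
  have hH i : ContinuousAt
      (fun x : (Fin k → EuclideanSpace ℝ (Fin n)) × EuclideanSpace ℝ (Fin k) =>
        fderiv ℝ (gradient (h i)) (x.1 i)) x₀ :=
    ContinuousAt.comp' ((hgrad i).fderiv_right (m := 0) (by norm_num)).continuousAt (hy i)
  have hlam i : ContinuousAt
      (fun x : (Fin k → EuclideanSpace ℝ (Fin n)) × EuclideanSpace ℝ (Fin k) =>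
        x.2 i) x₀ := by fun_prop
  have hA : ContinuousAt
      (fun x : (Fin k → EuclideanSpace ℝ (Fin n)) × EuclideanSpace ℝ (Fin k) =>
        ∑ i, x.2 i • fderiv ℝ (gradient (h i)) (x.1 i)) x₀ :=
    tendsto_finsetSum _ fun i _ => (hlam i).smul (hH i)
  obtain ⟨δ, hδ, hball⟩ := Metric.nhds_basis_closedBall.eventually_iff.mp
    (eventually_pos_of_orthogonal hG hA hpos)
  refine ⟨δ, hδ, fun y lam hy hlam => hball (x := (y, lam)) ?_⟩
  rw [← closedBall_prod_same]
  exact ⟨(dist_pi_le_iff hδ.le).mpr fun i => (dist_eq_norm _ _).trans_le (hy i),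
    mem_closedBall_iff_norm.mpr hlam⟩
end

section
/- Let x̄ satisfy the strong second-order conditions. Then x̄ is a strict local minimizer of f: there is a neighborhood U of x̄ such that f(x) > f(x̄) for all x ∈ U with x ≠ x̄. -/
open scoped RealInnerProductSpace

open Filter Topology

/-- A form of the mean value theorem: if `L x ≤ L a`, the derivative of `L` at some point of the
open segment from `a` to `x` is nonpositive in the direction `x - a`. -/
theorem exists_fderiv_nonpos_of_le {E : Type*} [NormedAddCommGroup E] [NormedSpace ℝ E]
    {L : E → ℝ} {L' : E → E →L[ℝ] ℝ} (hL : ∀ x, HasFDerivAt L (L' x) x) {a x : E}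
    (h : L x ≤ L a) : ∃ s ∈ Set.Ioo (0 : ℝ) 1, L' (a + s • (x - a)) (x - a) ≤ 0 := by
  have hd (t : ℝ) : HasDerivAt (fun t : ℝ => L (a + t • (x - a)))
      (L' (a + t • (x - a)) (x - a)) t := by
    have hline : HasDerivAt (fun t : ℝ => a + t • (x - a)) (x - a) t := by
      simpa using ((hasDerivAt_id t).smul_const (x - a)).const_add a
    exact (hL _).comp_hasDerivAt t hline
  obtain ⟨s, hs, hs'⟩ := exists_hasDerivAt_eq_slope _ _ one_pos
    (fun t _ => (hd t).continuousAt.continuousWithinAt) (fun t _ => hd t)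
  refine ⟨s, hs, ?_⟩
  rw [hs']
  simpa using h

theorem ContDiff.differentiable_gradient {E : Type*} [NormedAddCommGroup E]
    [InnerProductSpace ℝ E] [CompleteSpace E] {g : E → ℝ} (hg : ContDiff ℝ 2 g) :
    Differentiable ℝ (gradient g) :=
  (InnerProductSpace.toDual ℝ E).symm.differentiable.comp
    ((hg.fderiv_right (m := 1) (by norm_num)).differentiable one_ne_zero)

/-- Points different from `a` that accumulate at `a` have, along a subsequence, a limiting
direction. -/
theorem exists_seq_tendsto_direction {E : Type*} [NormedAddCommGroup E] [NormedSpace ℝ E]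
    [ProperSpace E] {a : E} {p : E → Prop} (h : ∃ᶠ x in 𝓝 a, x ≠ a ∧ p x) :
    ∃ (x : ℕ → E) (z : E), Tendsto x atTop (𝓝 a) ∧ (∀ r, x r ≠ a ∧ p (x r)) ∧ z ≠ 0 ∧
      Tendsto (fun r => ‖x r - a‖⁻¹ • (x r - a)) atTop (𝓝 z) := by
  obtain ⟨x, hx, hp⟩ := exists_seq_forall_of_frequently h
  obtain ⟨z, hz, ψ, hψ, hlim⟩ := (isCompact_sphere (0 : E) 1).tendsto_subseq
    (x := fun r => ‖x r - a‖⁻¹ • (x r - a)) fun r => by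
      simp [norm_smul, inv_mul_cancel₀ (norm_ne_zero_iff.2 (sub_ne_zero.2 (hp r).1))]
  exact ⟨x ∘ ψ, z, hx.comp hψ.tendsto_atTop, fun r => hp _,
    ne_zero_of_mem_unit_sphere ⟨z, hz⟩, hlim⟩

/-- Difference quotients along a sequence with limiting direction `z` converge to the
derivative in the direction `z`. -/
theorem HasFDerivAt.tendsto_smul_sub {E F : Type*} [NormedAddCommGroup E] [NormedSpace ℝ E]
    [NormedAddCommGroup F] [NormedSpace ℝ F] {g : E → F} {g' : E →L[ℝ] F} {a z : E}
    (hg : HasFDerivAt g g' a) {x : ℕ → E} (hx : Tendsto x atTop (𝓝 a))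
    (hz : Tendsto (fun r => ‖x r - a‖⁻¹ • (x r - a)) atTop (𝓝 z)) :
    Tendsto (fun r => ‖x r - a‖⁻¹ • (g (x r) - g a)) atTop (𝓝 (g' z)) := by
  simpa using hg.hasFDerivWithinAt.lim (s := Set.univ) (d := fun r => x r - a)
    (by simpa using hx.sub_const a) (by simp) hz

/-- the strong second-order conditions imply that `x̄` is a strict
local minimizer of `f = max_i f_i`. -/
theorem stmt8 {n k : ℕ} (φ : Fin k → EuclideanSpace ℝ (Fin n) → ℝ)
    (hC2 : ∀ i, ContDiff ℝ 2 (φ i))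
    (f : EuclideanSpace ℝ (Fin n) → ℝ) (hf : ∀ x, f x = ⨆ i, φ i x)
    (xbar : EuclideanSpace ℝ (Fin n))
    -- full activity
    (hact : ∀ i j, φ i xbar = φ j xbar)
    -- independence (affine independence of the gradients)
    (hindep : LinearIndependent ℝ
      (fun i => ((gradient (φ i) xbar, 1) : EuclideanSpace ℝ (Fin n) × ℝ)))
    -- stationarity
    (lambar : Fin k → ℝ) (hlam1 : ∑ i, lambar i = 1)
    (hstat : ∑ i, lambar i • gradient (φ i) xbar = 0)
    -- strict complementarity
    (hcomp : ∀ i, 0 < lambar i)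
    -- second-order sufficiency
    (hsos : ∀ z : EuclideanSpace ℝ (Fin n), z ≠ 0 →
      (∀ i j, ⟪gradient (φ i) xbar, z⟫ = ⟪gradient (φ j) xbar, z⟫) →
      0 < ⟪z, (∑ i, lambar i • fderiv ℝ (gradient (φ i)) xbar) z⟫) :
    ∃ U ∈ nhds xbar, ∀ x ∈ U, x ≠ xbar → f xbar < f x := by
  have hd (i) (x) : HasFDerivAt (φ i) (fderiv ℝ (φ i) x) x :=
    ((hC2 i).differentiable two_ne_zero x).hasFDerivAt
  have hgrad (i) (x v) : fderiv ℝ (φ i) x v = ⟪gradient (φ i) x, v⟫ := by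
    simp [gradient]
  by_contra hcon
  have hfreq : ∃ᶠ x in 𝓝 xbar, x ≠ xbar ∧ f x ≤ f xbar := by
    intro hev
    refine hcon ⟨_, hev, fun x hx hne => ?_⟩
    by_contra hlt
    exact hx ⟨hne, not_lt.1 hlt⟩
  obtain ⟨x, z, hx, hp, hz0, hz⟩ := exists_seq_tendsto_direction hfreq
  have hle (i) (r) : φ i (x r) ≤ φ i xbar := by
    have : Nonempty (Fin k) := ⟨i⟩
    calc φ i (x r) ≤ ⨆ j, φ j (x r) :=
          le_ciSup (f := fun j => φ j (x r)) (Set.finite_range _).bddAbove i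
      _ ≤ ⨆ j, φ j xbar := by simpa only [hf] using (hp r).2
      _ = φ i xbar := by rw [funext fun j => hact j i, ciSup_const]
  have hnonpos (i) : ⟪gradient (φ i) xbar, z⟫ ≤ 0 := by
    rw [← hgrad]
    exact le_of_tendsto' ((hd i xbar).tendsto_smul_sub hx hz) fun r =>
      mul_nonpos_of_nonneg_of_nonpos (by positivity) (sub_nonpos.2 (hle i r))
  have hsum : ∑ i, lambar i * ⟪gradient (φ i) xbar, z⟫ = 0 := by
    simpa [sum_inner, real_inner_smul_left] using congrArg (fun w => ⟪w, z⟫) hstat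
  have hzero (i) : ⟪gradient (φ i) xbar, z⟫ = 0 := by
    have h := (Finset.sum_eq_zero_iff_of_nonpos fun j _ =>
      mul_nonpos_of_nonneg_of_nonpos (hcomp j).le (hnonpos j)).1 hsum i (Finset.mem_univ i)
    exact (mul_eq_zero.1 h).resolve_left (hcomp i).ne'
  have hpos := hsos z hz0 fun i j => by rw [hzero i, hzero j]
  have hL (w) : HasFDerivAt (fun w => ∑ i, lambar i * φ i w)
      (∑ i, lambar i • fderiv ℝ (φ i) w) w :=
    HasFDerivAt.fun_sum fun i _ => (hd i w).const_mul (lambar i)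
  choose s hs hs' using fun r => exists_fderiv_nonpos_of_le hL (a := xbar) (x := x r)
    (Finset.sum_le_sum fun i _ => mul_le_mul_of_nonneg_left (hle i r) (hcomp i).le)
  set y : ℕ → EuclideanSpace ℝ (Fin n) := fun r => xbar + s r • (x r - xbar) with hy
  have hysub (r) : y r - xbar = s r • (x r - xbar) := by simp [hy]
  have hytend : Tendsto y atTop (𝓝 xbar) := by
    rw [tendsto_iff_norm_sub_tendsto_zero] at hx ⊢
    refine squeeze_zero (fun r => norm_nonneg _) (fun r => ?_) hx
    rw [hysub, norm_smul, Real.norm_of_nonneg (hs r).1.le]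
    exact mul_le_of_le_one_left (norm_nonneg _) (hs r).2.le
  have hydir : Tendsto (fun r => ‖y r - xbar‖⁻¹ • (y r - xbar)) atTop (𝓝 z) := by
    refine hz.congr fun r => ?_
    have := (hs r).1.ne'
    rw [hysub, norm_smul, Real.norm_of_nonneg (hs r).1.le, smul_smul]
    congr 1
    field_simp
  have hG : HasFDerivAt (fun w => ∑ i, lambar i • gradient (φ i) w)
      (∑ i, lambar i • fderiv ℝ (gradient (φ i)) xbar) xbar :=
    HasFDerivAt.fun_sum fun i _ =>
      ((hC2 i).differentiable_gradient xbar).hasFDerivAt.const_smul (lambar i)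
  refine hpos.not_ge (le_of_tendsto' (hydir.inner (hG.tendsto_smul_sub hytend hydir))
    fun r => ?_)
  have hyr : ⟪∑ i, lambar i • gradient (φ i) (y r), x r - xbar⟫ ≤ 0 := by
    simpa only [sum_inner, real_inner_smul_left, sum_apply,
      smul_apply, smul_eq_mul, hgrad] using hs' r
  rw [hstat, sub_zero, real_inner_smul_left, real_inner_smul_right, hysub,
    real_inner_smul_left, real_inner_comm]
  have := (hs r).1.le
  exact mul_nonpos_of_nonneg_of_nonpos (by positivity) (mul_nonpos_of_nonneg_of_nonpos
    (by positivity) (mul_nonpos_of_nonneg_of_nonpos this hyr))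
end

section
/- Suppose 0 ∈ conv{∇f_i(x̄) : i = 1, …, k} and, for every index j, 0 ∉ conv{∇f_i(x̄) : i ≠ j}. Then there exists ε > 0 such that for every full bundle S in B_ε(x̄) and every k-element set S' ⊂ D ∩ B_ε(x̄) that is not a full bundle (i.e. S' ∩ D_j = ∅ for some j), one has Θ(S) < Θ(S'). -/
/-- The activity region of index `i` for the family `φ`. -/
def activityRegion {n k : ℕ} (φ : Fin k → EuclideanSpace ℝ (Fin n) → ℝ) (i : Fin k) :
    Set (EuclideanSpace ℝ (Fin n)) :=
  {x | ∀ j, j ≠ i → φ j x < φ i x}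

/-- The optimality measure `Θ(A) = min{|g| : g ∈ conv ∇f(A)}` of a set `A`. -/
noncomputable def optMeasure {n : ℕ} (f : EuclideanSpace ℝ (Fin n) → ℝ)
    (A : Set (EuclideanSpace ℝ (Fin n))) : ℝ :=
  sInf {t : ℝ | ∃ g ∈ convexHull ℝ (gradient f '' A), t = ‖g‖}

open Filter Topology in
/-- On an activity region, the gradient of the maximum is the gradient of the active function. -/
theorem gradient_eq_of_mem_activityRegion {n k : ℕ}
    {φ : Fin k → EuclideanSpace ℝ (Fin n) → ℝ} (hφ : ∀ i, Continuous (φ i))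
    {f : EuclideanSpace ℝ (Fin n) → ℝ} (hf : ∀ x, f x = ⨆ i, φ i x) {i : Fin k}
    {x : EuclideanSpace ℝ (Fin n)} (hx : x ∈ activityRegion φ i) :
    gradient f x = gradient (φ i) x := by
  have hnear : ∀ᶠ y in 𝓝 x, ∀ j, j ≠ i → φ j y < φ i y := by
    refine eventually_all.2 fun j => ?_
    by_cases hj : j = i
    · exact Eventually.of_forall fun y h => absurd hj h
    · filter_upwards [(hφ j).continuousAt.eventually_lt (hφ i).continuousAt (hx j hj)] with y hy _
      exact hy
  have heq : f =ᶠ[𝓝 x] φ i := by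
    filter_upwards [hnear] with y hy
    have : Nonempty (Fin k) := ⟨i⟩
    rw [hf]
    refine le_antisymm (ciSup_le fun j => ?_) 
      (le_ciSup (f := fun j => φ j y) (Set.finite_range _).bddAbove i)
    by_cases hj : j = i
    · rw [hj]
    · exact (hy j hj).le
  simp only [gradient, heq.fderiv_eq]

/-- Passing to convex hulls does not increase the one-sided Hausdorff distance. -/
theorem exists_mem_convexHull_norm_sub_le {E : Type*} [SeminormedAddCommGroup E] [NormedSpace ℝ E]
    {A B : Set E} {r : ℝ} (h : ∀ a ∈ A, ∃ b ∈ B, ‖a - b‖ ≤ r) {a : E} (ha : a ∈ convexHull ℝ A) :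
    ∃ b ∈ convexHull ℝ B, ‖a - b‖ ≤ r := by
  let C : Set E := {a | ∃ b ∈ convexHull ℝ B, ‖a - b‖ ≤ r}
  have hC : Convex ℝ C := by
    rintro x ⟨b, hb, hxb⟩ y ⟨c, hc, hyc⟩ s t hs ht hst
    refine ⟨s • b + t • c, convex_convexHull ℝ B hb hc hs ht hst, ?_⟩
    calc ‖s • x + t • y - (s • b + t • c)‖ = ‖s • (x - b) + t • (y - c)‖ := by
          congr 1; module
      _ ≤ ‖s • (x - b)‖ + ‖t • (y - c)‖ := norm_add_le _ _
      _ = s * ‖x - b‖ + t * ‖y - c‖ := by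
          rw [norm_smul, norm_smul, Real.norm_of_nonneg hs, Real.norm_of_nonneg ht]
      _ ≤ s * r + t * r := by gcongr
      _ = r := by rw [← add_mul, hst, one_mul]
  refine convexHull_min (t := C) (fun a ha => ?_) hC ha
  obtain ⟨b, hb, hab⟩ := h a ha
  exact ⟨b, subset_convexHull ℝ B hb, hab⟩

/-- The convex hull of a finite set that misses the origin stays away from the origin. -/
theorem Set.Finite.exists_pos_le_norm_of_zero_notMem_convexHull {E : Type*}
    [NormedAddCommGroup E] [NormedSpace ℝ E] {A : Set E} (hA : A.Finite)
    (h : (0 : E) ∉ convexHull ℝ A) : ∃ δ > 0, ∀ g ∈ convexHull ℝ A, δ ≤ ‖g‖ := by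
  obtain ⟨δ, hδ, hball⟩ := Metric.isOpen_iff.1 (hA.isCompact_convexHull (𝕜 := ℝ)).isClosed.isOpen_compl 0 h
  refine ⟨δ, hδ, fun g hg => ?_⟩
  by_contra! hlt
  exact hball (mem_ball_zero_iff.2 hlt) hg

/-- A finite family of continuous maps is jointly continuous at a point, in closed-ball form. -/
theorem exists_pos_forall_norm_sub_le {ι E F : Type*} [Finite ι] [SeminormedAddCommGroup E]
    [SeminormedAddCommGroup F] {G : ι → E → F} {x₀ : E} (hG : ∀ i, ContinuousAt (G i) x₀)
    {r : ℝ} (hr : 0 < r) :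
    ∃ ε > 0, ∀ i x, ‖x - x₀‖ ≤ ε → ‖G i x - G i x₀‖ ≤ r := by
  have hnear : ∀ᶠ x in nhds x₀, ∀ i, dist (G i x) (G i x₀) < r :=
    Filter.eventually_all.2 fun i => Metric.tendsto_nhds.1 (hG i) r hr
  obtain ⟨ε, hε, hball⟩ := Metric.nhds_basis_closedBall.eventually_iff.1 hnear
  refine ⟨ε, hε, fun i x hx => ?_⟩
  rw [← dist_eq_norm] at hx ⊢
  exact (hball (Metric.mem_closedBall.2 hx) i).le

theorem optMeasure_le_norm {n : ℕ} {f : EuclideanSpace ℝ (Fin n) → ℝ}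
    {A : Set (EuclideanSpace ℝ (Fin n))} {g : EuclideanSpace ℝ (Fin n)}
    (hg : g ∈ convexHull ℝ (gradient f '' A)) : optMeasure f A ≤ ‖g‖ := by
  refine csInf_le ⟨0, ?_⟩ ⟨g, hg, rfl⟩
  rintro _ ⟨h, -, rfl⟩
  exact norm_nonneg h

theorem le_optMeasure {n : ℕ} {f : EuclideanSpace ℝ (Fin n) → ℝ}
    {A : Set (EuclideanSpace ℝ (Fin n))} (hA : A.Nonempty) {c : ℝ}
    (h : ∀ g ∈ convexHull ℝ (gradient f '' A), c ≤ ‖g‖) : c ≤ optMeasure f A := by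
  obtain ⟨g, hg⟩ := (hA.image (gradient f)).convexHull (𝕜 := ℝ)
  refine le_csInf ⟨‖g‖, g, hg, rfl⟩ ?_
  rintro _ ⟨g, hg, rfl⟩
  exact h g hg

/-- near `x̄`, full bundles have strictly smaller optimality measure
than bundles that are not full. -/
theorem stmt12 {n k : ℕ} (φ : Fin k → EuclideanSpace ℝ (Fin n) → ℝ)
    (hC2 : ∀ i, ContDiff ℝ 2 (φ i))
    (f : EuclideanSpace ℝ (Fin n) → ℝ) (hf : ∀ x, f x = ⨆ i, φ i x)
    (xbar : EuclideanSpace ℝ (Fin n))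
    (h0 : (0 : EuclideanSpace ℝ (Fin n)) ∈
      convexHull ℝ (Set.range fun i => gradient (φ i) xbar))
    (h0' : ∀ j, (0 : EuclideanSpace ℝ (Fin n)) ∉
      convexHull ℝ {g | ∃ i, i ≠ j ∧ g = gradient (φ i) xbar}) :
    ∃ ε > (0:ℝ),
      -- for every full bundle in the closed ball of radius ε ...
      ∀ x : Fin k → EuclideanSpace ℝ (Fin n),
        (∀ i, x i ∈ activityRegion φ i ∧ ‖x i - xbar‖ ≤ ε) →
      -- ... and every k-element subset of D ∩ B_ε(x̄) that is not full,
      ∀ S' : Finset (EuclideanSpace ℝ (Fin n)), S'.card = k →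
        (∀ s ∈ S', (∃ i, s ∈ activityRegion φ i) ∧ ‖s - xbar‖ ≤ ε) →
        (∃ j, ∀ s ∈ S', s ∉ activityRegion φ j) →
        optMeasure f (Set.range x) < optMeasure f ↑S' := by
  have hkne : Nonempty (Fin k) :=
    Set.range_nonempty_iff_nonempty.1 (convexHull_nonempty_iff.1 ⟨0, h0⟩)
  have hdist : ∀ j, ∃ δ > 0, ∀ g ∈ convexHull ℝ {g | ∃ i, i ≠ j ∧ g = gradient (φ i) xbar},
      δ ≤ ‖g‖ := fun j =>
    ((Set.finite_range fun i => gradient (φ i) xbar).subset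
      (by rintro _ ⟨i, -, rfl⟩; exact ⟨i, rfl⟩)).exists_pos_le_norm_of_zero_notMem_convexHull (h0' j)
  choose d hd hdle using hdist
  obtain ⟨m, hm⟩ := Finite.exists_min d
  have hgrad : ∀ i, Continuous (gradient (φ i)) := fun i =>
    (InnerProductSpace.toDual ℝ (EuclideanSpace ℝ (Fin n))).symm.continuous.comp
      ((hC2 i).continuous_fderiv (by norm_num))
  have hr : 0 < d m / 3 := by linarith [hd m]
  obtain ⟨ε, hε, hclose⟩ :=
    exists_pos_forall_norm_sub_le (fun i => (hgrad i).continuousAt (x := xbar)) hr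
  have hfgrad {i : Fin k} {x : EuclideanSpace ℝ (Fin n)} (hx : x ∈ activityRegion φ i) :
      gradient f x = gradient (φ i) x :=
    gradient_eq_of_mem_activityRegion (fun i => (hC2 i).continuous) hf hx
  refine ⟨ε, hε, fun x hx S' hcard hS' ⟨j, hj⟩ => ?_⟩
  have hfull : optMeasure f (Set.range x) ≤ d m / 3 := by
    obtain ⟨g, hg, hgle⟩ := exists_mem_convexHull_norm_sub_le
      (B := gradient f '' Set.range x) (r := d m / 3) (by
        rintro _ ⟨i, rfl⟩
        refine ⟨_, ⟨x i, ⟨i, rfl⟩, rfl⟩, ?_⟩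
        rw [hfgrad (hx i).1, norm_sub_rev]
        exact hclose i (x i) (hx i).2) h0
    rw [zero_sub, norm_neg] at hgle
    exact (optMeasure_le_norm hg).trans hgle
  have hne : (S' : Set (EuclideanSpace ℝ (Fin n))).Nonempty := by
    rw [Finset.coe_nonempty, ← Finset.card_pos, hcard]
    exact Fin.pos_iff_nonempty.2 hkne
  have hnotfull : 2 * (d m / 3) ≤ optMeasure f ↑S' := by
    refine le_optMeasure hne fun g hg => ?_
    obtain ⟨b, hb, hgb⟩ := exists_mem_convexHull_norm_sub_le
      (B := {g | ∃ i, i ≠ j ∧ g = gradient (φ i) xbar}) (r := d m / 3) (by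
        rintro _ ⟨s, hs, rfl⟩
        obtain ⟨⟨i, hi⟩, hsε⟩ := hS' s hs
        refine ⟨_, ⟨i, fun hij => hj s hs (hij ▸ hi), rfl⟩, ?_⟩
        rw [hfgrad hi]
        exact hclose i s hsε) hg
    have hbg := norm_sub_norm_le b g
    rw [norm_sub_rev] at hbg
    linarith [hdle j b hb, hm j]
  linarith
end

section
/- Given constants ε, M > 0, there exists δ > 0 with the following property. Let (z^r)_{r≥0} be any sequence of vectors in the nonnegative orthant ℝᵏ₊ with ‖z⁰‖_max ≤ δ such that, for each r, there exists an index i with z^{r+1}_j = z^r_j for all j ≠ i, z^r_i ≥ ε‖z^r‖_max, and z^{r+1}_i ≤ M‖z^r‖²_max. Then ‖z^{r+k}‖_max ≤ (M/ε)‖z^r‖²_max for every r, and consequently z^r → 0 as r → ∞ at a k-step quadratic rate. -/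
/-- While `M * ‖z r‖ ≤ 1`, replacing one coordinate by a value at most `M * ‖z r‖ ^ 2`
does not increase the sup norm. -/
theorem norm_antitone_of_step {k : ℕ} {M : ℝ} (hM : 0 < M) {z : ℕ → (Fin k → ℝ)}
    {i : ℕ → Fin k} (hz : ∀ r j, 0 ≤ z r j) (h0 : M * ‖z 0‖ ≤ 1)
    (hfix : ∀ r j, j ≠ i r → z (r + 1) j = z r j)
    (hstep : ∀ r, z (r + 1) (i r) ≤ M * ‖z r‖ ^ 2) :
    Antitone fun r => ‖z r‖ := by
  have hmono : ∀ r, M * ‖z r‖ ≤ 1 → ‖z (r + 1)‖ ≤ ‖z r‖ := by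
    intro r hr
    refine (pi_norm_le_iff_of_nonneg (norm_nonneg _)).2 fun j => ?_
    by_cases hj : j = i r
    · subst hj
      rw [Real.norm_of_nonneg (hz _ _)]
      nlinarith [hstep r, norm_nonneg (z r)]
    · rw [hfix r j hj]
      exact norm_le_pi_norm (z r) j
  have hle : ∀ r, M * ‖z r‖ ≤ 1 := by
    intro r
    induction r with
    | zero => exact h0
    | succ r ih => exact (mul_le_mul_of_nonneg_left (hmono r ih) hM.le).trans ih
  exact antitone_nat_of_succ_le fun r => hmono r (hle r)

/-- A coordinate updated at time `s ≥ r` stays at most `M * ‖z r‖ ^ 2` afterwards. -/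
theorem updated_coord_le {k : ℕ} {M : ℝ} (hM : 0 < M) {z : ℕ → (Fin k → ℝ)}
    {i : ℕ → Fin k} (hanti : Antitone fun r => ‖z r‖)
    (hfix : ∀ r j, j ≠ i r → z (r + 1) j = z r j)
    (hstep : ∀ r, z (r + 1) (i r) ≤ M * ‖z r‖ ^ 2) {r s t : ℕ} (hrs : r ≤ s) (hst : s < t) :
    z t (i s) ≤ M * ‖z r‖ ^ 2 := by
  have hbound : ∀ u, r ≤ u → z (u + 1) (i u) ≤ M * ‖z r‖ ^ 2 := by
    intro u hu
    have hnorm : ‖z u‖ ≤ ‖z r‖ := hanti hu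
    exact (hstep u).trans (by gcongr)
  induction t, hst using Nat.le_induction with
  | base => exact hbound s hrs
  | succ t hst ih =>
    by_cases h : i s = i t
    · rw [h]
      exact hbound t (by omega)
    · rw [hfix t _ h]
      exact ih

/-- Among the `k + 1` times `r, …, r + k` some coordinate is selected twice; at the second time it
is quadratically small, yet comparable with the norm. -/
theorem norm_add_le_quadratic {k : ℕ} {ε M : ℝ} (hε : 0 < ε) (hM : 0 < M)
    {z : ℕ → (Fin k → ℝ)} {i : ℕ → Fin k}
    (hanti : Antitone fun r => ‖z r‖)
    (hfix : ∀ r j, j ≠ i r → z (r + 1) j = z r j)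
    (hlarge : ∀ r, ε * ‖z r‖ ≤ z r (i r))
    (hstep : ∀ r, z (r + 1) (i r) ≤ M * ‖z r‖ ^ 2) (r : ℕ) :
    ‖z (r + k)‖ ≤ (M / ε) * ‖z r‖ ^ 2 := by
  rw [div_mul_eq_mul_div, le_div_iff₀' hε]
  have htwice : ∀ s t, r ≤ s → s < t → t ≤ r + k → i s = i t →
      ε * ‖z (r + k)‖ ≤ M * ‖z r‖ ^ 2 := by
    intro s t hrs hst ht heq
    have hcoord := updated_coord_le hM hanti hfix hstep hrs hst
    rw [heq] at hcoord
    have hnorm : ‖z (r + k)‖ ≤ ‖z t‖ := hanti ht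
    exact (mul_le_mul_of_nonneg_left hnorm hε.le).trans ((hlarge t).trans hcoord)
  obtain ⟨s, t, hne, heq⟩ := Fintype.exists_ne_map_eq_of_card_lt
    (fun t : Fin (k + 1) => i (r + t)) (by simp)
  rcases lt_or_gt_of_ne (Fin.val_ne_of_ne hne) with h | h
  · exact htwice (r + s) (r + t) (by omega) (by omega) (by omega) heq
  · exact htwice (r + t) (r + s) (by omega) (by omega) (by omega) heq.symm

/-- the `k`-step quadratic convergence tool.  Here the norm on
`Fin k → ℝ` is the sup norm `‖z‖ = max_j |z_j|`. -/
theorem stmt15 {k : ℕ} (ε M : ℝ) (hε : 0 < ε) (hM : 0 < M) :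
    ∃ δ > (0:ℝ), ∀ z : ℕ → (Fin k → ℝ),
      (∀ r j, 0 ≤ z r j) → ‖z 0‖ ≤ δ →
      (∀ r, ∃ i, (∀ j, j ≠ i → z (r+1) j = z r j) ∧
        ε * ‖z r‖ ≤ z r i ∧ z (r+1) i ≤ M * ‖z r‖ ^ 2) →
      (∀ r, ‖z (r+k)‖ ≤ (M / ε) * ‖z r‖ ^ 2) ∧
      Filter.Tendsto z Filter.atTop (nhds 0) := by
  refine ⟨min (1 / M) (ε / (2 * M)), by positivity, fun z hz h0 hex => ?_⟩
  choose i hfix hlarge hstep using hex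
  have hδM : M * ‖z 0‖ ≤ 1 := (le_div_iff₀' hM).1 (h0.trans (min_le_left _ _))
  have hδε : 2 * M * ‖z 0‖ ≤ ε :=
    (le_div_iff₀' (by positivity)).1 (h0.trans (min_le_right _ _))
  have hanti := norm_antitone_of_step hM hz hδM hfix hstep
  have hquad := norm_add_le_quadratic hε hM hanti hfix hlarge hstep
  refine ⟨hquad, ?_⟩
  have hhalf : ∀ r, ‖z (r + k)‖ ≤ 1 / 2 * ‖z r‖ := by
    intro r
    have hr : ‖z r‖ ≤ ‖z 0‖ := hanti (Nat.zero_le r)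
    refine (hquad r).trans ?_
    rw [div_mul_eq_mul_div, div_le_iff₀ hε]
    have hrε : 2 * M * ‖z r‖ ≤ ε := (mul_le_mul_of_nonneg_left hr (by positivity)).trans hδε
    nlinarith [mul_le_mul_of_nonneg_right hrε (norm_nonneg (z r))]
  rw [tendsto_zero_iff_norm_tendsto_zero]
  have hbdd : BddBelow (Set.range fun r => ‖z r‖) :=
    ⟨0, by rintro _ ⟨r, rfl⟩; exact norm_nonneg _⟩
  have hlim := tendsto_atTop_ciInf hanti hbdd
  have hnonneg : 0 ≤ ⨅ r, ‖z r‖ := Real.iInf_nonneg fun r => norm_nonneg _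
  have hle := le_of_tendsto_of_tendsto' (hlim.comp (Filter.tendsto_add_atTop_nat k))
    (hlim.const_mul (1 / 2)) hhalf
  have hzero : ⨅ r, ‖z r‖ = 0 := by linarith
  rwa [hzero] at hlim
end
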